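/- arXiv:2111.07112 — 4 statements merged into one kernel-verified Lean document; each statement's English description precedes it below -/
import Mathlib

section
/- Let 0 < ε < min(1/e, √3/2) and let f_ε(r) = arctan(r/ε²) + (arctan ε)·r/ε for r ∈ [0, ε]. Then for every r ∈ [0, ε], (1/2)·ε²·r·(ε⁴ + r²)^{-3/2} ≤ d/dr(−cos f_ε(r)) ≤ 6·ε²·r·(ε⁴ + r²)^{-3/2}, where d/dr(−cos f_ε(r)) = sin(f_ε(r))·f_ε'(r). -/
open MeasureTheory Filter Topology Real

/-- The zenith-angle function `f_ε(r) = arctan(r/ε²) + (arctan ε)·r/ε`. -/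
noncomputable def fe (ε r : ℝ) : ℝ := Real.arctan (r / ε ^ 2) + Real.arctan ε * r / ε

/-- Its derivative `f_ε'(r) = ε²/(ε⁴ + r²) + (arctan ε)/ε`. -/
noncomputable def fder (ε r : ℝ) : ℝ := ε ^ 2 / (ε ^ 4 + r ^ 2) + Real.arctan ε / ε

/-- for `0 < ε < min(1/e, √3/2)` and `r ∈ [0, ε]`,
`(1/2)·ε²·r·(ε⁴+r²)^{-3/2} ≤ sin(f_ε(r))·f_ε'(r) ≤ 6·ε²·r·(ε⁴+r²)^{-3/2}`,
where `sin(f_ε(r))·f_ε'(r) = d/dr(−cos f_ε(r))`. -/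
theorem deriv_neg_cos_fe_bounds (ε : ℝ) (hε0 : 0 < ε)
    (hε : ε < min (1 / Real.exp 1) (Real.sqrt 3 / 2)) :
    ∀ r ∈ Set.Icc (0 : ℝ) ε,
      (1 / 2) * ε ^ 2 * r * (ε ^ 4 + r ^ 2) ^ (-(3 : ℝ) / 2)
          ≤ Real.sin (fe ε r) * fder ε r ∧
        Real.sin (fe ε r) * fder ε r
          ≤ 6 * ε ^ 2 * r * (ε ^ 4 + r ^ 2) ^ (-(3 : ℝ) / 2) := by
  intro r hr
  obtain ⟨hr0, hrε⟩ := hr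
  have hε1 : ε < 1 := by
    have h1 : ε < 1 / Real.exp 1 := lt_of_lt_of_le hε (min_le_left _ _)
    have h2 : 1 / Real.exp 1 ≤ 1 := by
      rw [div_le_one (Real.exp_pos 1)]
      exact Real.one_le_exp (by norm_num)
    linarith
  have ha0 : 0 < Real.arctan ε := Real.arctan_pos.mpr hε0
  have haε : Real.arctan ε ≤ ε := by
    have := Real.le_tan ha0.le (Real.arctan_lt_pi_div_two ε)
    rwa [Real.tan_arctan] at this
  have hq1 : Real.arctan ε / ε ≤ 1 := (div_le_one hε0).mpr haε
  have hq0 : 0 ≤ Real.arctan ε / ε := by positivity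
  have hD : 0 < ε ^ 4 + r ^ 2 := by positivity
  have hs : 0 < Real.sqrt (ε ^ 4 + r ^ 2) := Real.sqrt_pos.mpr hD
  have hpow : (ε ^ 4 + r ^ 2) ^ (-(3 : ℝ) / 2)
      = 1 / (Real.sqrt (ε ^ 4 + r ^ 2) * (ε ^ 4 + r ^ 2)) := by
    rw [show (-(3 : ℝ) / 2) = -(1 / 2 + 1) by norm_num, Real.rpow_neg hD.le,
      Real.rpow_add hD, Real.rpow_one, ← Real.sqrt_eq_rpow, one_div]
  have hsq : Real.sqrt (1 + (r / ε ^ 2) ^ 2) = Real.sqrt (ε ^ 4 + r ^ 2) / ε ^ 2 := by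
    rw [show 1 + (r / ε ^ 2) ^ 2 = (ε ^ 4 + r ^ 2) / (ε ^ 2) ^ 2 by field_simp,
      Real.sqrt_div hD.le, Real.sqrt_sq (by positivity)]
  have hsin : Real.sin (Real.arctan (r / ε ^ 2)) = r / Real.sqrt (ε ^ 4 + r ^ 2) := by
    rw [Real.sin_arctan, hsq]
    field_simp
  have hcos : Real.cos (Real.arctan (r / ε ^ 2)) = ε ^ 2 / Real.sqrt (ε ^ 4 + r ^ 2) := by
    rw [Real.cos_arctan, hsq]
    field_simp
  have hb0 : 0 ≤ Real.arctan ε * r / ε := by positivity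
  have hf : fe ε r ≤ Real.pi / 2 := by
    unfold fe
    have h1 : Real.arctan (r / ε ^ 2) ≤ Real.arctan (ε⁻¹) := by
      apply Real.arctan_strictMono.monotone
      rw [div_le_iff₀ (by positivity)]
      have : ε⁻¹ * ε ^ 2 = ε := by field_simp
      linarith
    rw [Real.arctan_inv_of_pos hε0] at h1
    have h2 : Real.arctan ε * r / ε ≤ Real.arctan ε := by
      rw [div_le_iff₀ hε0]
      exact mul_le_mul_of_nonneg_left hrε ha0.le
    linarith
  have hlow : r / Real.sqrt (ε ^ 4 + r ^ 2) ≤ Real.sin (fe ε r) := by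
    rw [← hsin]
    apply Real.sin_le_sin_of_le_of_le_pi_div_two _ hf
    · unfold fe
      linarith
    · exact (Real.neg_pi_div_two_lt_arctan _).le
  have hup : Real.sin (fe ε r) ≤ r / Real.sqrt (ε ^ 4 + r ^ 2) * (1 + ε ^ 2) := by
    unfold fe
    rw [Real.sin_add, hsin, hcos]
    have h1 : Real.sin (Real.arctan ε * r / ε) ≤ r := by
      refine (Real.sin_le hb0).trans ?_
      rw [div_le_iff₀ hε0]
      nlinarith
    have h2 := Real.cos_le_one (Real.arctan ε * r / ε)
    calc _ ≤ r / Real.sqrt (ε ^ 4 + r ^ 2) * 1 + ε ^ 2 / Real.sqrt (ε ^ 4 + r ^ 2) * r := by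
          gcongr
      _ = _ := by ring
  have hd1 : ε ^ 2 / (ε ^ 4 + r ^ 2) ≤ fder ε r := by
    unfold fder
    linarith
  have hd0 : 0 ≤ ε ^ 2 / (ε ^ 4 + r ^ 2) := by positivity
  have hd2 : fder ε r ≤ ε ^ 2 * (2 + ε ^ 2) / (ε ^ 4 + r ^ 2) := by
    have h1 : fder ε r ≤ ε ^ 2 / (ε ^ 4 + r ^ 2) + 1 := by
      unfold fder
      linarith
    refine h1.trans ?_
    rw [div_add_one hD.ne']
    gcongr
    nlinarith
  have hX : 0 ≤ r / Real.sqrt (ε ^ 4 + r ^ 2) := by positivity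
  have hT : 0 ≤ r / Real.sqrt (ε ^ 4 + r ^ 2) * (ε ^ 2 / (ε ^ 4 + r ^ 2)) := by positivity
  have hform : ∀ c : ℝ, c * ε ^ 2 * r * (1 / (Real.sqrt (ε ^ 4 + r ^ 2) * (ε ^ 4 + r ^ 2)))
      = c * (r / Real.sqrt (ε ^ 4 + r ^ 2) * (ε ^ 2 / (ε ^ 4 + r ^ 2))) := by
    intro c
    field_simp
  rw [hpow, hform, hform]
  constructor
  · have := mul_le_mul hlow hd1 hd0 (hX.trans hlow)
    linarith
  · have h1 := mul_le_mul hup hd2 (hd0.trans hd1) (by positivity)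
    refine h1.trans ?_
    have h2 : (1 + ε ^ 2) * (2 + ε ^ 2) ≤ 6 := by
      have : ε ^ 2 ≤ 1 := by nlinarith
      nlinarith [sq_nonneg ε]
    calc _ = (1 + ε ^ 2) * (2 + ε ^ 2)
          * (r / Real.sqrt (ε ^ 4 + r ^ 2) * (ε ^ 2 / (ε ^ 4 + r ^ 2))) := by ring
      _ ≤ _ := mul_le_mul_of_nonneg_right h2 hT
end

section
/- Let 0 < ε < min(1/e, √3/2) and let f_ε(r) = arctan(r/ε²) + (arctan ε)·r/ε for r ∈ [0, ε]. Then for every r ∈ (0, ε], the derivative of the function r ↦ r / (d/dr(cos f_ε(r))) satisfies |d/dr ( r / (d/dr(cos f_ε(r))) )| ≤ 64·ε^{-2}·r·(ε⁴ + r²)^{1/2} ≤ 64·√2. -/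
open MeasureTheory Filter Topology Real

theorem aux_cube_bound {δ r : ℝ} (h0 : 0 < δ) (h1 : δ ≤ r) (hr : r ≤ 1) :
    |Real.sin δ - δ * Real.cos δ| ≤ r ^ 3 / 2 := by
  have a1 : Real.sin δ < δ := Real.sin_lt h0
  have a2 : δ - δ ^ 3 / 6 < Real.sin δ := Real.sin_gt_sub_cube h0
  have a3 := Real.one_sub_sq_div_two_le_cos (x := δ)
  have a4 := Real.cos_le_one δ
  have a5 : δ ^ 3 ≤ r ^ 3 := pow_le_pow_left₀ h0.le h1 3
  have a6 : 0 < δ ^ 3 := by positivity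
  have a7 : δ * (1 - δ ^ 2 / 2) ≤ δ * Real.cos δ := mul_le_mul_of_nonneg_left a3 h0.le
  have a8 : δ * Real.cos δ ≤ δ * 1 := mul_le_mul_of_nonneg_left a4 h0.le
  rw [abs_le]
  constructor <;> nlinarith

theorem aux_P_bound {δ r ρ e S C : ℝ} (h0 : 0 < δ) (h1 : δ ≤ r) (hr : r ≤ 1) (hρ : 0 < ρ)
    (hρ1 : ρ ≤ 1) (he0 : 0 < e) (he1 : e ≤ 1) (hS : S = r / ρ) (hC : C = e / ρ)
    (hC1 : C ≤ 1) (hSC : S ^ 2 + C ^ 2 = 1) :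
    |(S * Real.cos δ + C * Real.sin δ)
      - (C * Real.cos δ - S * Real.sin δ) * (S * C + δ)| ≤ 4 * (r ^ 3 / ρ ^ 3) := by
  have hr0 : 0 < r := by linarith
  have key : (S * Real.cos δ + C * Real.sin δ)
      - (C * Real.cos δ - S * Real.sin δ) * (S * C + δ)
      = S ^ 3 * Real.cos δ + S ^ 2 * C * Real.sin δ + δ * S * Real.sin δ
        + C * (Real.sin δ - δ * Real.cos δ) := by
    linear_combination (-(S * Real.cos δ)) * hSC
  have hS0 : 0 < S := by rw [hS]; positivity
  have hC0 : 0 < C := by rw [hC]; positivity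
  have hSr : r ≤ S := by rw [hS, le_div_iff₀ hρ]; nlinarith
  have hs3 : r ^ 3 / ρ ^ 3 = S ^ 3 := by rw [hS, div_pow]
  have hs0 : 0 < Real.sin δ := Real.sin_pos_of_pos_of_lt_pi h0 (by linarith [Real.pi_gt_three])
  have hs1 : Real.sin δ ≤ r := (Real.sin_lt h0).le.trans h1
  have hc0 : 0 ≤ Real.cos δ := by
    have := Real.one_sub_sq_div_two_le_cos (x := δ)
    nlinarith
  have hc1 := Real.cos_le_one δ
  have t4 := aux_cube_bound h0 h1 hr
  have hr3 : r ^ 3 ≤ S ^ 3 := pow_le_pow_left₀ hr0.le hSr 3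
  have t4' : |C * (Real.sin δ - δ * Real.cos δ)| ≤ S ^ 3 := by
    rw [abs_mul, abs_of_pos hC0]
    have := mul_le_mul hC1 t4 (abs_nonneg _) zero_le_one
    have : 0 < S ^ 3 := by positivity
    linarith
  have t1 : S ^ 3 * Real.cos δ ≤ S ^ 3 := mul_le_of_le_one_right (by positivity) hc1
  have t2 : S ^ 2 * C * Real.sin δ ≤ S ^ 3 := by
    calc S ^ 2 * C * Real.sin δ ≤ S ^ 2 * 1 * S := by
          gcongr
          linarith
      _ = S ^ 3 := by ring
  have t3 : δ * S * Real.sin δ ≤ S ^ 3 := by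
    calc δ * S * Real.sin δ ≤ S * S * S := by
          gcongr
          · linarith
          · linarith
      _ = S ^ 3 := by ring
  have p1 : 0 ≤ S ^ 3 * Real.cos δ := by positivity
  have p2 : 0 ≤ S ^ 2 * C * Real.sin δ := by positivity
  have p3 : 0 ≤ δ * S * Real.sin δ := by positivity
  rw [key, hs3]
  rw [abs_le] at t4' ⊢
  constructor <;> linarith [t4'.1, t4'.2]

theorem aux_final {P r ρ e s F : ℝ} (hr : 0 < r) (hρ : 0 < ρ) (he : 0 < e)
    (hP : |P| ≤ 4 * (r ^ 3 / ρ ^ 3)) (hs : r / ρ ≤ s) (hF : e / ρ ^ 2 ≤ F) :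
    |F * P + 2 * r ^ 2 * e * s / ρ ^ 4| ≤ 64 * e⁻¹ * r * ρ * (s * F) ^ 2 := by
  have hs0 : 0 < s := lt_of_lt_of_le (by positivity) hs
  have hF0 : 0 < F := lt_of_lt_of_le (by positivity) hF
  have b1 : F * (4 * (r ^ 3 / ρ ^ 3)) ≤ 4 * e⁻¹ * r * ρ * (s * F) ^ 2 := by
    calc F * (4 * (r ^ 3 / ρ ^ 3)) = 4 * e⁻¹ * r * ρ * ((r / ρ) ^ 2 * (F * (e / ρ ^ 2))) := by
          field_simp
      _ ≤ 4 * e⁻¹ * r * ρ * (s ^ 2 * (F * F)) := by gcongr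
      _ = _ := by ring
  have b2 : 2 * r ^ 2 * e * s / ρ ^ 4 ≤ 2 * e⁻¹ * r * ρ * (s * F) ^ 2 := by
    calc 2 * r ^ 2 * e * s / ρ ^ 4 = 2 * e⁻¹ * r * ρ * (s * (r / ρ) * (e / ρ ^ 2) ^ 2) := by
          field_simp
      _ ≤ 2 * e⁻¹ * r * ρ * (s * s * F ^ 2) := by gcongr
      _ = _ := by ring
  have b0 : 0 ≤ e⁻¹ * r * ρ * (s * F) ^ 2 := by positivity
  calc |F * P + 2 * r ^ 2 * e * s / ρ ^ 4| ≤ |F * P| + |2 * r ^ 2 * e * s / ρ ^ 4| := abs_add_le _ _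
    _ = F * |P| + 2 * r ^ 2 * e * s / ρ ^ 4 := by
        rw [abs_mul, abs_of_pos hF0, abs_of_pos (a := 2 * r ^ 2 * e * s / ρ ^ 4) (by positivity)]
    _ ≤ F * (4 * (r ^ 3 / ρ ^ 3)) + 2 * r ^ 2 * e * s / ρ ^ 4 := by gcongr
    _ ≤ _ := by linarith

theorem aux_hasDerivAt_fe {ε : ℝ} (h : 0 < ε) (r : ℝ) : HasDerivAt (fe ε) (fder ε r) r := by
  have h1 : HasDerivAt (fun t : ℝ => t / ε ^ 2) (1 / ε ^ 2) r := (hasDerivAt_id r).div_const _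
  have h2 : HasDerivAt (fun t : ℝ => Real.arctan ε * t / ε) (Real.arctan ε * 1 / ε) r :=
    ((hasDerivAt_id r).const_mul _).div_const _
  have h3 := h1.arctan.add h2
  have : fder ε r = 1 / (1 + (r / ε ^ 2) ^ 2) * (1 / ε ^ 2) + Real.arctan ε * 1 / ε := by
    unfold fder
    have : ε ^ 4 + r ^ 2 ≠ 0 := by positivity
    field_simp
  rw [this]
  exact h3

theorem aux_hasDerivAt_fder {ε : ℝ} (h : 0 < ε) (r : ℝ) :
    HasDerivAt (fder ε) (-(2 * r * ε ^ 2) / (ε ^ 4 + r ^ 2) ^ 2) r := by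
  have h1 : HasDerivAt (fun t : ℝ => ε ^ 4 + t ^ 2) (2 * r) r := by
    simpa using (hasDerivAt_pow 2 r).const_add (ε ^ 4)
  have h0 : ε ^ 4 + r ^ 2 ≠ 0 := by positivity
  have h2 := ((hasDerivAt_const r (ε ^ 2)).div h1 h0).add_const (Real.arctan ε / ε)
  have h3 : -(2 * r * ε ^ 2) / (ε ^ 4 + r ^ 2) ^ 2
      = (0 * (ε ^ 4 + r ^ 2) - ε ^ 2 * (2 * r)) / (ε ^ 4 + r ^ 2) ^ 2 := by
    congr 1
    ring
  rw [h3]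
  exact h2

/-- for `0 < ε < min(1/e, √3/2)` and `r ∈ (0, ε]`, the derivative of
`r ↦ r / (d/dr(cos f_ε(r)))`, where `d/dr(cos f_ε(r)) = −sin(f_ε(r))·f_ε'(r)`, satisfies
`|d/dr ( r / (d/dr(cos f_ε(r))) )| ≤ 64·ε^{-2}·r·(ε⁴+r²)^{1/2} ≤ 64·√2`. -/
theorem deriv_r_div_deriv_cos_fe_bound (ε : ℝ) (hε0 : 0 < ε)
    (hε : ε < min (1 / Real.exp 1) (Real.sqrt 3 / 2)) :
    ∀ r ∈ Set.Ioc (0 : ℝ) ε,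
      |deriv (fun t => t / (-(Real.sin (fe ε t) * fder ε t))) r|
          ≤ 64 * (ε ^ 2)⁻¹ * r * Real.sqrt (ε ^ 4 + r ^ 2) ∧
        64 * (ε ^ 2)⁻¹ * r * Real.sqrt (ε ^ 4 + r ^ 2) ≤ 64 * Real.sqrt 2 := by
  rintro r ⟨hr0, hrε⟩
  have he1 : ε ≤ 1 / 2 := by
    have h1 := lt_of_lt_of_le hε (min_le_left _ _)
    have h2 : (2 : ℝ) ≤ Real.exp 1 := by linarith [Real.add_one_le_exp (1 : ℝ)]
    have h3 : 1 / Real.exp 1 ≤ 1 / 2 := one_div_le_one_div_of_le (by norm_num) h2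
    linarith
  have hD0 : 0 < ε ^ 4 + r ^ 2 := by positivity
  have he2 : ε ^ 2 ≤ 1 / 4 := by nlinarith
  have he4 : ε ^ 4 ≤ ε ^ 2 := by nlinarith [sq_nonneg ε]
  have hr2 : r ^ 2 ≤ ε ^ 2 := by nlinarith
  set ρ := Real.sqrt (ε ^ 4 + r ^ 2) with hρdef
  have hρ : 0 < ρ := Real.sqrt_pos.mpr hD0
  have hρ2 : ρ ^ 2 = ε ^ 4 + r ^ 2 := Real.sq_sqrt hD0.le
  have hρ1 : ρ ≤ 1 := by nlinarith
  constructor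
  · set x := r / ε ^ 2 with hx
    have hx0 : 0 < x := by positivity
    set δ := Real.arctan ε * r / ε with hδ
    have hat0 : 0 < Real.arctan ε := Real.arctan_pos.mpr hε0
    have hδ0 : 0 < δ := by positivity
    have hat1 : Real.arctan ε ≤ ε := by
      have := Real.le_tan hat0.le (Real.arctan_lt_pi_div_two ε)
      rwa [Real.tan_arctan] at this
    have hδr : δ ≤ r := by
      rw [hδ, div_le_iff₀ hε0]
      nlinarith
    have hδa : δ ≤ Real.arctan ε := by
      rw [hδ, div_le_iff₀ hε0]
      nlinarith
    have hsq : Real.sqrt (1 + x ^ 2) = ρ / ε ^ 2 := by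
      rw [Real.sqrt_eq_iff_mul_self_eq (by positivity) (by positivity)]
      rw [hx]
      field_simp
      rw [hρ2]
    have hS : Real.sin (Real.arctan x) = r / ρ := by
      rw [Real.sin_arctan, hsq, hx]
      field_simp
    have hC : Real.cos (Real.arctan x) = ε ^ 2 / ρ := by
      rw [Real.cos_arctan, hsq]
      field_simp
    have hfe : fe ε r = Real.arctan x + δ := rfl
    have hle : fe ε r ≤ π / 2 := by
      have h1 : Real.arctan x ≤ Real.arctan ε⁻¹ := by
        apply Real.arctan_mono
        rw [hx, div_le_iff₀ (by positivity)]
        have : ε⁻¹ * ε ^ 2 = ε := by field_simp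
        linarith
      rw [Real.arctan_inv_of_pos hε0] at h1
      rw [hfe]
      linarith
    have hs : r / ρ ≤ Real.sin (fe ε r) := by
      rw [← hS]
      have := Real.arctan_pos.mpr hx0
      exact Real.sin_le_sin_of_le_of_le_pi_div_two (by linarith [Real.pi_pos]) hle
        (by rw [hfe]; linarith)
    have hs0 : 0 < Real.sin (fe ε r) := lt_of_lt_of_le (by positivity) hs
    have hF : ε ^ 2 / ρ ^ 2 ≤ fder ε r := by
      unfold fder
      rw [hρ2]
      have : 0 < Real.arctan ε / ε := by positivity
      linarith
    have hF0 : 0 < fder ε r := lt_of_lt_of_le (by positivity) hF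
    have hP := aux_P_bound hδ0 hδr (by linarith) hρ hρ1 (by positivity : 0 < ε ^ 2) (by linarith)
      hS hC (Real.cos_le_one _) (Real.sin_sq_add_cos_sq _)
    rw [← Real.sin_add, ← Real.cos_add, ← hfe] at hP
    have hrf : Real.sin (Real.arctan x) * Real.cos (Real.arctan x) + δ = r * fder ε r := by
      rw [hS, hC]
      unfold fder
      rw [← hρ2, hδ]
      field_simp
    rw [hrf] at hP
    have hfin := aux_final hr0 hρ (by positivity : 0 < ε ^ 2) hP hs hF
    have hne : -(Real.sin (fe ε r) * fder ε r) ≠ 0 := by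
      have : 0 < Real.sin (fe ε r) * fder ε r := by positivity
      linarith
    have hder := (hasDerivAt_id r).div
      (((aux_hasDerivAt_fe hε0 r).sin.mul (aux_hasDerivAt_fder hε0 r)).neg) hne
    have hder' := hder.deriv
    have hval : deriv (fun t => t / (-(Real.sin (fe ε t) * fder ε t))) r =
        -((fder ε r * (Real.sin (fe ε r) - Real.cos (fe ε r) * (r * fder ε r))
          + 2 * r ^ 2 * ε ^ 2 * Real.sin (fe ε r) / ρ ^ 4)
          / (Real.sin (fe ε r) * fder ε r) ^ 2) := by
      refine hder'.trans ?_
      have h4 : ρ ^ 4 = (ε ^ 4 + r ^ 2) ^ 2 := by rw [← hρ2]; ring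
      simp only [Pi.neg_apply, Pi.mul_apply, id]
      rw [h4, neg_sq, ← neg_div]
      congr 1
      ring
    rw [hval, abs_neg, abs_div, abs_of_pos (a := (Real.sin (fe ε r) * fder ε r) ^ 2)
      (by positivity), div_le_iff₀ (by positivity)]
    exact hfin
  · have h1 : ρ ≤ Real.sqrt 2 * ε := by
      rw [hρdef]
      apply Real.sqrt_le_iff.mpr
      refine ⟨by positivity, ?_⟩
      rw [mul_pow, Real.sq_sqrt (by norm_num)]
      linarith
    calc 64 * (ε ^ 2)⁻¹ * r * ρ ≤ 64 * (ε ^ 2)⁻¹ * ε * (Real.sqrt 2 * ε) := by gcongr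
      _ = 64 * Real.sqrt 2 := by field_simp
end

section
/- Fix γ with 0 < γ ≤ 1/3. Then lim_{ε→0⁺} ∫_{x₃=0}^{1} ∫_{r=0}^{ε} [ r·(∂u_ρ^ε/∂r (r, x₃))² + r·(u_ρ^ε(r, x₃)·f_ε'(r))² ] dr dx₃ = 1/2, where ∂u_ρ^ε/∂r denotes the partial derivative in r of the explicit function u_ρ^ε. -/
open MeasureTheory Filter Topology Real

/-- The radial component of the recovery sequence in region `c_ε`:
`u_ρ^ε(r, x₃) = ((cos f_ε(r) + 2ε^γ)³ + 3·x₃·r/(sin(f_ε(r))·f_ε'(r)))^{1/3}`. -/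
noncomputable def urho (γ ε r x : ℝ) : ℝ :=
  ((Real.cos (fe ε r) + 2 * ε ^ γ) ^ 3
      + 3 * x * r / (Real.sin (fe ε r) * fder ε r)) ^ ((1 : ℝ) / 3)

/-- second derivative of `fe` -/
noncomputable def fdd (ε r : ℝ) : ℝ := -(2 * ε ^ 2 * r) / (ε ^ 4 + r ^ 2) ^ 2

noncomputable def hh (ε r : ℝ) : ℝ := r / (Real.sin (fe ε r) * fder ε r)

noncomputable def hder (ε r : ℝ) : ℝ :=
  (Real.sin (fe ε r) * fder ε r
    - r * (Real.cos (fe ε r) * fder ε r * fder ε r + Real.sin (fe ε r) * fdd ε r))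
    / (Real.sin (fe ε r) * fder ε r) ^ 2

noncomputable def gg (η ε r : ℝ) : ℝ := Real.cos (fe ε r) + 2 * η

lemma hasDerivAt_fe {ε : ℝ} (hε : 0 < ε) (r : ℝ) : HasDerivAt (fe ε) (fder ε r) r := by
  have h1 : HasDerivAt (fun r : ℝ => r / ε ^ 2) (1 / ε ^ 2) r := (hasDerivAt_id r).div_const _
  have h2 : HasDerivAt (fun r : ℝ => Real.arctan ε * r / ε) (Real.arctan ε * 1 / ε) r :=
    ((hasDerivAt_id r).const_mul _).div_const _
  have h : HasDerivAt (fe ε) _ r := h1.arctan.add h2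
  refine h.congr_deriv ?_
  unfold fder
  have : 0 < ε ^ 4 + r ^ 2 := by positivity
  have : 0 < 1 + (r / ε ^ 2) ^ 2 := by positivity
  field_simp

lemma hasDerivAt_fder {ε : ℝ} (hε : 0 < ε) (r : ℝ) : HasDerivAt (fder ε) (fdd ε r) r := by
  have hp : ε ^ 4 + r ^ 2 ≠ 0 := by positivity
  have h1 : HasDerivAt (fun r : ℝ => ε ^ 4 + r ^ 2) (2 * r) r := by
    simpa using (hasDerivAt_pow 2 r).const_add (ε ^ 4)
  have h : HasDerivAt (fder ε) _ r :=
    ((hasDerivAt_const r (ε ^ 2)).div h1 hp).add_const (Real.arctan ε / ε)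
  refine h.congr_deriv ?_
  unfold fdd
  field_simp
  ring

lemma sin_ge_half {t : ℝ} (h0 : 0 ≤ t) (h1 : t ≤ π / 2) : t / 2 ≤ Real.sin t := by
  have h := Real.mul_le_sin h0 h1
  have : 1 / 2 ≤ 2 / π := by
    rw [div_le_div_iff₀ (by norm_num) Real.pi_pos]; linarith [Real.pi_le_four]
  nlinarith

lemma mul_cos_le_sin {t : ℝ} (h0 : 0 ≤ t) (h1 : t ≤ π / 2) : t * Real.cos t ≤ Real.sin t := by
  rcases h1.eq_or_lt with h | h
  · rw [h]; simp
  · have hc : 0 < Real.cos t := Real.cos_pos_of_mem_Ioo ⟨by linarith [Real.pi_pos], h⟩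
    have := Real.le_tan h0 h
    rw [Real.tan_eq_sin_div_cos, le_div_iff₀ hc] at this
    exact this

lemma arctan_bounds {ε : ℝ} (hε : 0 < ε) (h1 : ε ≤ 1) :
    1 / 2 ≤ Real.arctan ε / ε ∧ Real.arctan ε / ε ≤ 1 := by
  have hpos : 0 ≤ Real.arctan ε := Real.arctan_nonneg.2 hε.le
  constructor
  · rw [le_div_iff₀ hε]
    have h := Real.sin_le hpos
    rw [Real.sin_arctan] at h
    have hs : √(1 + ε ^ 2) ≤ 2 := by
      rw [Real.sqrt_le_left (by norm_num)]; nlinarith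
    have hs0 : 0 < √(1 + ε ^ 2) := by positivity
    refine le_trans ?_ h
    rw [le_div_iff₀ hs0]
    nlinarith
  · rw [div_le_one hε]
    have := Real.le_tan hpos (Real.arctan_lt_pi_div_two ε)
    rwa [Real.tan_arctan] at this

set_option maxHeartbeats 1000000 in
/-- Basic pointwise facts. -/
lemma basic {ε r : ℝ} (hε : 0 < ε) (h1 : ε ≤ 1) (hr : 0 < r) (hrε : r < ε) :
    0 < fe ε r ∧ fe ε r ≤ π / 2 ∧ r ≤ 2 * ε * fe ε r ∧ 1 / 2 ≤ fder ε r
      ∧ r * fder ε r ≤ 2 ∧ |hder ε r| ≤ 40 ∧ hh ε r ≤ 8 * ε := by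
  obtain ⟨ha1, ha2⟩ := arctan_bounds hε h1
  set a := Real.arctan ε / ε with ha
  set θ := Real.arctan (r / ε ^ 2) with hθ
  set p := ε ^ 2 / (ε ^ 4 + r ^ 2) with hp
  have hf : fe ε r = θ + a * r := by
    unfold fe; rw [ha]; ring
  have hfd : fder ε r = p + a := rfl
  have hR : 0 < ε ^ 4 + r ^ 2 := by positivity
  have hp0 : 0 < p := by positivity
  have hθ0 : 0 < θ := Real.arctan_pos.2 (by positivity)
  have hθ1 : θ < π / 2 := Real.arctan_lt_pi_div_two _
  have hf0 : 0 < fe ε r := by rw [hf]; positivity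
  have hθf : θ ≤ fe ε r := by rw [hf]; nlinarith
  have hf1 : fe ε r ≤ π / 2 := by
    have e1 : θ ≤ Real.arctan ε⁻¹ := by
      apply Real.arctan_strictMono.monotone
      rw [div_le_iff₀ (by positivity)]
      field_simp; exact hrε.le
    rw [Real.arctan_inv_of_pos hε] at e1
    have e2 : a * r ≤ Real.arctan ε := by
      have : a * ε = Real.arctan ε := by rw [ha]; field_simp
      nlinarith
    rw [hf]; linarith
  have hrf : r ≤ 2 * ε * fe ε r := by
    have h := Real.sin_le hθ0.le
    rw [hθ, Real.sin_arctan, ← hθ] at h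
    have hs0 : 0 < √(1 + (r / ε ^ 2) ^ 2) := by positivity
    have hs : √(1 + (r / ε ^ 2) ^ 2) ≤ 2 / ε := by
      rw [Real.sqrt_le_left (by positivity), div_pow, div_pow]
      have : r ^ 2 ≤ ε ^ 2 := by nlinarith
      have h3 : ε ^ 2 ≤ 1 := by nlinarith
      have : r ^ 2 / (ε ^ 2) ^ 2 ≤ 1 / ε ^ 2 := by
        rw [div_le_div_iff₀ (by positivity) (by positivity)]; nlinarith [sq_nonneg ε]
      have : 1 ≤ 1 / ε ^ 2 := by rw [le_div_iff₀ (by positivity)]; linarith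
      have : (2 : ℝ) ^ 2 / ε ^ 2 = 4 * (1 / ε ^ 2) := by ring
      linarith [sq_nonneg (1 / ε)]
    rw [div_le_iff₀ hs0] at h
    have h4 : r / ε ^ 2 ≤ θ * (2 / ε) := h.trans (by gcongr)
    have h5 : r ≤ 2 * ε * θ := by
      rw [div_le_iff₀ (by positivity)] at h4
      calc r ≤ _ := h4
        _ = _ := by field_simp
    nlinarith
  have hfd2 : 1 / 2 ≤ fder ε r := by rw [hfd]; linarith
  have hrp : r * p ≤ 1 / 2 := by
    rw [hp, ← mul_div_assoc, div_le_div_iff₀ hR (by norm_num)]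
    nlinarith [sq_nonneg (r - ε ^ 2)]
  have hrfd : r * fder ε r ≤ 2 := by rw [hfd]; nlinarith
  have hsin : fe ε r / 2 ≤ Real.sin (fe ε r) := sin_ge_half hf0.le hf1
  have hcos0 : 0 ≤ Real.cos (fe ε r) := Real.cos_nonneg_of_mem_Icc ⟨by linarith, hf1⟩
  have hcos1 : Real.cos (fe ε r) ≤ 1 := Real.cos_le_one _
  have hπ : π ≤ 4 := Real.pi_le_four
  have hsinpos : 0 < Real.sin (fe ε r) := by linarith
  have hfdpos : 0 < fder ε r := by linarith
  refine ⟨hf0, hf1, hrf, hfd2, hrfd, ?_, ?_⟩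
  · -- numerators
    have hrp' : r * p = Real.sin θ * Real.cos θ := by
      rw [hθ, Real.sin_arctan, Real.cos_arctan, hp, div_mul_div_comm,
        Real.mul_self_sqrt (by positivity)]
      field_simp
    have hθs : 0 ≤ Real.sin θ := Real.sin_nonneg_of_nonneg_of_le_pi hθ0.le (by linarith)
    have hθc : 0 ≤ Real.cos θ := Real.cos_nonneg_of_mem_Icc ⟨by linarith, hθ1.le⟩
    have hB0 : 0 ≤ θ - r * p := by
      rw [hrp']
      nlinarith [Real.sin_le hθ0.le, Real.cos_le_one θ]
    have hB1 : θ - r * p ≤ θ ^ 3 := by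
      rw [hrp']
      have e1 := mul_cos_le_sin hθ0.le hθ1.le
      have e2 := Real.sin_sq_add_cos_sq θ
      have e3 := Real.sin_le hθ0.le
      have e4 : Real.sin θ ^ 2 ≤ θ ^ 2 := by gcongr
      have e5 := mul_le_mul_of_nonneg_right e1 hθc
      have e6 := mul_le_mul_of_nonneg_left e4 hθ0.le
      have e7 : θ * Real.cos θ * Real.cos θ = θ - θ * Real.sin θ ^ 2 := by
        have : Real.cos θ ^ 2 = 1 - Real.sin θ ^ 2 := by linarith
        linear_combination θ * this
      nlinarith
    have hA0 := mul_cos_le_sin hf0.le hf1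
    have hA1 : Real.sin (fe ε r) - fe ε r * Real.cos (fe ε r) ≤ fe ε r ^ 3 / 2 := by
      have e1 := Real.sin_le hf0.le
      have e2 := Real.one_sub_sq_div_two_le_cos (x := fe ε r)
      nlinarith
    set N := Real.sin (fe ε r) - r * fder ε r * Real.cos (fe ε r) with hN
    have hNe : N = (Real.sin (fe ε r) - fe ε r * Real.cos (fe ε r))
        + (θ - r * p) * Real.cos (fe ε r) := by
      rw [hN, hfd]; linear_combination Real.cos (fe ε r) * hf
    have hθ3 : θ ^ 3 ≤ fe ε r ^ 3 := by gcongr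
    have hN0 : 0 ≤ N := by
      rw [hNe]; have := mul_nonneg hB0 hcos0; linarith
    have hN1 : N ≤ 2 * fe ε r ^ 3 := by
      have : (θ - r * p) * Real.cos (fe ε r) ≤ (θ - r * p) * 1 := by gcongr
      have : 0 ≤ fe ε r ^ 3 := by positivity
      rw [hNe]; linarith
    have hsplit : hder ε r = N / (Real.sin (fe ε r) ^ 2 * fder ε r)
        + (r * (2 * ε ^ 2 * r / (ε ^ 4 + r ^ 2) ^ 2)) / (Real.sin (fe ε r) * fder ε r ^ 2) := by
      unfold hder fdd
      rw [hN]
      have := hsinpos.ne'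
      have := hfdpos.ne'
      field_simp
      ring
    have hT1 : N / (Real.sin (fe ε r) ^ 2 * fder ε r) ≤ 32 := by
      rw [div_le_iff₀ (by positivity)]
      have e1 : fe ε r ^ 2 / 4 ≤ Real.sin (fe ε r) ^ 2 := by
        have : (fe ε r / 2) ^ 2 ≤ Real.sin (fe ε r) ^ 2 := by gcongr
        linarith
      have e2 : fe ε r ^ 2 / 4 * (1 / 2) ≤ Real.sin (fe ε r) ^ 2 * fder ε r := by gcongr
      have e3 : fe ε r ^ 3 ≤ fe ε r ^ 2 * 2 := by
        rw [pow_succ]; gcongr; linarith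
      linarith
    have hT2 : (r * (2 * ε ^ 2 * r / (ε ^ 4 + r ^ 2) ^ 2)) /
        (Real.sin (fe ε r) * fder ε r ^ 2) ≤ 8 := by
      rw [div_le_iff₀ (by positivity)]
      have e1 : r * (2 * ε ^ 2 * r / (ε ^ 4 + r ^ 2) ^ 2) = 2 * r ^ 2 / ε ^ 2 * p ^ 2 := by
        rw [hp]; field_simp
      have e2 : p ^ 2 ≤ fder ε r ^ 2 := by
        have : p ≤ fder ε r := by rw [hfd]; linarith
        gcongr
      have e3 : 2 * r ^ 2 / ε ^ 2 ≤ 8 * Real.sin (fe ε r) := by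
        rw [div_le_iff₀ (by positivity)]
        nlinarith [mul_pos hε hε, mul_pos hε hr]
      rw [e1, ← mul_assoc]
      gcongr
    have hT0 : 0 ≤ N / (Real.sin (fe ε r) ^ 2 * fder ε r) := by positivity
    have hT0' : 0 ≤ (r * (2 * ε ^ 2 * r / (ε ^ 4 + r ^ 2) ^ 2)) /
        (Real.sin (fe ε r) * fder ε r ^ 2) := by positivity
    rw [hsplit, abs_of_nonneg (by linarith)]
    linarith
  · unfold hh
    rw [div_le_iff₀ (by positivity)]
    have : fe ε r / 2 * (1 / 2) ≤ Real.sin (fe ε r) * fder ε r := by gcongr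
    nlinarith

set_option maxHeartbeats 1000000 in
/-- Algebra of the pointwise energy estimate. -/
lemma algebra {ε r x η u g h h' c s F M : ℝ} (hε : 0 < ε) (hr : 0 < r) (hrε : r < ε)
    (hη : 0 < η) (hεη : ε ≤ η ^ 3) (hx : 0 < x) (hx1 : x < 1) (hF : 1 / 2 ≤ F) (hrF : r * F ≤ 2)
    (hh' : |h'| ≤ 40) (hh0 : 0 ≤ h) (hh8 : h ≤ 8 * ε) (hc : 0 ≤ c) (hs : 0 ≤ s)
    (hcs : s ^ 2 + c ^ 2 = 1) (hg : g = c + 2 * η) (hu : 0 < u) (hu3 : u ^ 3 = g ^ 3 + 3 * x * h)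
    (hhr : s * F * h = r) (hM1 : M ≤ r * F ^ 2) (hM2 : r * F ^ 2 ≤ M + 2) :
    |ε * (r * ((g ^ 2 * (-s * F) + x * h') / u ^ 2) ^ 2 + r * (u * F) ^ 2 - M)|
      ≤ ε * ((4 * η * (2 + 4 * η)) * (M + 2)) + (2 * ε + 2 * ε + 40 * η + 100 * η ^ 2) := by
  have hg0 : 2 * η ≤ g := by linarith
  have hgpos : 0 < g := by linarith
  have hc1 : c ≤ 1 := by nlinarith
  have hs1 : s ≤ 1 := by nlinarith
  have hgu : g ≤ u := by
    by_contra hlt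
    push Not at hlt
    have : u ^ 3 < g ^ 3 := by gcongr
    nlinarith [mul_nonneg hx.le hh0]
  have hxh : x * h ≤ h := by nlinarith
  -- u - g
  have hug : u - g ≤ 2 * η := by
    have e1 : (u - g) * (3 * g ^ 2) ≤ 3 * h := by
      have : (u - g) * (u ^ 2 + u * g + g ^ 2) = 3 * x * h := by linear_combination hu3
      have : 3 * g ^ 2 ≤ u ^ 2 + u * g + g ^ 2 := by nlinarith
      nlinarith [mul_le_mul_of_nonneg_left this (sub_nonneg.2 hgu)]
    have e2 : (2 * η) ^ 2 ≤ g ^ 2 := by gcongr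
    have e3 : (u - g) * (3 * (2 * η) ^ 2) ≤ (u - g) * (3 * g ^ 2) := by
      have := sub_nonneg.2 hgu
      gcongr
    have e4 : (u - g) * (12 * η ^ 2) ≤ (2 * η) * (12 * η ^ 2) := by
      nlinarith
    exact le_of_mul_le_mul_right e4 (by positivity)
  have huc : u - c ≤ 4 * η := by linarith
  have huc0 : 0 ≤ u - c := by linarith
  have hD : u ^ 2 - c ^ 2 ≤ 4 * η * (2 + 4 * η) := by
    have : (u - c) * (u + c) ≤ 4 * η * (2 + 4 * η) := by
      apply mul_le_mul huc (by linarith) (by linarith) (by positivity)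
    linarith [this, (by ring : (u - c) * (u + c) = u ^ 2 - c ^ 2)]
  have hD0 : 0 ≤ u ^ 2 - c ^ 2 := by nlinarith
  have hP2 : (u ^ 2 - c ^ 2) * (r * F ^ 2) ≤ 4 * η * (2 + 4 * η) * (M + 2) :=
    mul_le_mul hD hM2 (by positivity) (by positivity)
  have hP20 : 0 ≤ (u ^ 2 - c ^ 2) * (r * F ^ 2) := by positivity
  set k := g ^ 2 / u ^ 2 with hk
  set e := x * h' / u ^ 2 with he
  have hk0 : 0 ≤ k := by positivity
  have hk1 : k ≤ 1 := by rw [hk, div_le_one (by positivity)]; gcongr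
  have hur : (g ^ 2 * (-s * F) + x * h') / u ^ 2 = -k * (s * F) + e := by
    rw [hk, he]; ring
  have hee : |e| ≤ 10 / η ^ 2 := by
    rw [he, abs_div, abs_mul, abs_of_pos hx, abs_of_pos (by positivity : 0 < u ^ 2),
      div_le_div_iff₀ (by positivity) (by positivity)]
    have e1 : (2 * η) ^ 2 ≤ u ^ 2 := by gcongr; linarith
    have e2 : x * |h'| ≤ 40 := by nlinarith [abs_nonneg h']
    have e3 := mul_le_mul_of_nonneg_right e2 (sq_nonneg η)
    have e4 : (2 * η) ^ 2 = 4 * η ^ 2 := by ring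
    linarith
  have hεe : ε * |e| ≤ 10 * η := by
    calc ε * |e| ≤ η ^ 3 * (10 / η ^ 2) := by gcongr
      _ = 10 * η := by field_simp
  -- first error
  have hk2 : 1 - k ^ 2 ≤ 6 * h / g ^ 3 := by
    set q := g / u with hq
    have hq0 : 0 ≤ q := by positivity
    have hq1 : q ≤ 1 := by rw [hq, div_le_one hu]; exact hgu
    have hkq : k = q ^ 2 := by rw [hk, hq, div_pow]
    have hq3 : 1 - q ^ 3 ≤ 3 * h / g ^ 3 := by
      have : 1 - q ^ 3 = 3 * x * h / u ^ 3 := by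
        rw [hq, div_pow, eq_div_iff (by positivity), sub_mul, div_mul_cancel₀ _ (by positivity)]
        linarith
      rw [this]
      apply div_le_div₀ (by positivity) (by linarith) (by positivity)
      gcongr
    have h64 : q ^ 6 ≤ q ^ 4 := pow_le_pow_of_le_one hq0 hq1 (by norm_num)
    have h3 : q ^ 3 ≤ 1 := pow_le_one₀ hq0 hq1
    have h3' : 0 ≤ q ^ 3 := by positivity
    have : 6 * h / g ^ 3 = 2 * (3 * h / g ^ 3) := by ring
    rw [hkq, this]
    nlinarith
  have hk20 : 0 ≤ 1 - k ^ 2 := by nlinarith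
  have hsF : r * (s * F) ≤ 2 := by nlinarith [mul_nonneg hr.le (by linarith : 0 ≤ F)]
  have hsF0 : 0 ≤ s * F := by have : 0 ≤ F := by linarith
                              positivity
  have hE1 : r * ((1 - k ^ 2) * (s * F) ^ 2) ≤ 2 := by
    calc r * ((1 - k ^ 2) * (s * F) ^ 2) ≤ r * (6 * h / g ^ 3 * (s * F) ^ 2) := by gcongr
      _ = 6 * (r * (s * F)) * (s * F * h) / g ^ 3 := by ring
      _ = 6 * (r * (s * F)) * r / g ^ 3 := by rw [hhr]
      _ ≤ 6 * 2 * ε / (2 * η) ^ 3 := by gcongr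
      _ ≤ 2 := by
        rw [div_le_iff₀ (by positivity)]; nlinarith [pow_pos hη 3]
  have hE10 : 0 ≤ r * ((1 - k ^ 2) * (s * F) ^ 2) := by positivity
  have hE2 : |ε * (2 * r * k * (s * F) * e)| ≤ 40 * η := by
    have : ε * (2 * r * k * (s * F) * e) = (ε * e) * (2 * k * (r * (s * F))) := by ring
    rw [this, abs_mul, abs_mul, abs_of_pos hε,
      abs_of_nonneg (by positivity : 0 ≤ 2 * k * (r * (s * F)))]
    calc ε * |e| * (2 * k * (r * (s * F))) ≤ 10 * η * (2 * 1 * 2) := by gcongr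
      _ = 40 * η := by ring
  have hE3 : ε * (r * e ^ 2) ≤ 100 * η ^ 2 := by
    calc ε * (r * e ^ 2) ≤ ε * (ε * e ^ 2) := by gcongr
      _ = (ε * |e|) ^ 2 := by rw [mul_pow, sq_abs]; ring
      _ ≤ (10 * η) ^ 2 := by gcongr
      _ = 100 * η ^ 2 := by ring
  have hE30 : 0 ≤ ε * (r * e ^ 2) := by positivity
  rw [hur]
  have key : ε * (r * (-k * (s * F) + e) ^ 2 + r * (u * F) ^ 2 - M)
      = ε * ((u ^ 2 - c ^ 2) * (r * F ^ 2)) + ε * (r * F ^ 2 - M)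
        - ε * (r * ((1 - k ^ 2) * (s * F) ^ 2)) - ε * (2 * r * k * (s * F) * e)
        + ε * (r * e ^ 2) := by
    linear_combination (ε * r * F ^ 2) * hcs
  rw [key]
  have a1 := mul_le_mul_of_nonneg_left hP2 hε.le
  have a2 := mul_nonneg hε.le hP20
  have a3 := mul_le_mul_of_nonneg_left hE1 hε.le
  have a4 := mul_nonneg hε.le hE10
  have a5 : ε * (r * F ^ 2 - M) ≤ ε * 2 := by gcongr; linarith
  have a6 : 0 ≤ ε * (r * F ^ 2 - M) := mul_nonneg hε.le (by linarith)
  have a7 := abs_le.1 hE2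
  rw [abs_le]
  constructor <;> linarith [a7.1, a7.2, sq_nonneg η]
lemma deriv_urho {γ ε r x : ℝ} (hε : 0 < ε) (h1 : ε ≤ 1) (hr : 0 < r) (hrε : r < ε) (hx : 0 < x) :
    deriv (fun t => urho γ ε t x) r
      = (gg (ε ^ γ) ε r ^ 2 * (-Real.sin (fe ε r) * fder ε r) + x * hder ε r) / urho γ ε r x ^ 2
    ∧ 0 < urho γ ε r x ∧ urho γ ε r x ^ 3 = gg (ε ^ γ) ε r ^ 3 + 3 * x * hh ε r := by
  obtain ⟨hf0, hf1, -, hF, -, -, -⟩ := basic hε h1 hr hrε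
  have hsin : 0 < Real.sin (fe ε r) := by linarith [sin_ge_half hf0.le hf1]
  have hcos : 0 ≤ Real.cos (fe ε r) := Real.cos_nonneg_of_mem_Icc ⟨by linarith, hf1⟩
  have hη : 0 < ε ^ γ := Real.rpow_pos_of_pos hε γ
  have hg : 0 < gg (ε ^ γ) ε r := by unfold gg; linarith
  have hF0 : 0 < fder ε r := by linarith
  have hh0 : 0 ≤ hh ε r := by unfold hh; positivity
  have hW : ∀ t, urho γ ε t x = (gg (ε ^ γ) ε t ^ 3 + 3 * x * hh ε t) ^ ((1 : ℝ) / 3) := by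
    intro t; unfold urho gg hh; rw [mul_div_assoc (3 * x)]
  have hWpos : 0 < gg (ε ^ γ) ε r ^ 3 + 3 * x * hh ε r := by positivity
  have hu : 0 < urho γ ε r x := by rw [hW]; exact Real.rpow_pos_of_pos hWpos _
  have hu3 : urho γ ε r x ^ 3 = gg (ε ^ γ) ε r ^ 3 + 3 * x * hh ε r := by
    rw [hW, ← Real.rpow_natCast, ← Real.rpow_mul hWpos.le]
    norm_num
  refine ⟨?_, hu, hu3⟩
  have dF := hasDerivAt_fder hε r
  have df := hasDerivAt_fe hε r
  have dg : HasDerivAt (gg (ε ^ γ) ε) (-Real.sin (fe ε r) * fder ε r) r :=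
    df.cos.add_const _
  have dh : HasDerivAt (hh ε) (hder ε r) r := by
    have h : HasDerivAt (hh ε) _ r := (hasDerivAt_id r).div (df.sin.mul dF) (by
      show Real.sin (fe ε r) * fder ε r ≠ 0
      positivity)
    refine h.congr_deriv ?_
    unfold hder
    simp
  have dW : HasDerivAt (fun t => gg (ε ^ γ) ε t ^ 3 + 3 * x * hh ε t)
      (3 * gg (ε ^ γ) ε r ^ 2 * (-Real.sin (fe ε r) * fder ε r) + 3 * x * hder ε r) r := by
    have h : HasDerivAt (fun t => gg (ε ^ γ) ε t ^ 3 + 3 * x * hh ε t) _ r :=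
      (dg.pow 3).add (dh.const_mul (3 * x))
    refine h.congr_deriv ?_
    simp
  have du := dW.rpow_const (p := (1 : ℝ) / 3) (Or.inl hWpos.ne')
  have hfun : (fun t => urho γ ε t x)
      = fun t => (gg (ε ^ γ) ε t ^ 3 + 3 * x * hh ε t) ^ ((1 : ℝ) / 3) := funext hW
  rw [hfun, du.deriv]
  have e : (gg (ε ^ γ) ε r ^ 3 + 3 * x * hh ε r) ^ ((1 : ℝ) / 3 - 1) = 1 / urho γ ε r x ^ 2 := by
    rw [hW]
    generalize gg (ε ^ γ) ε r ^ 3 + 3 * x * hh ε r = w at hWpos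
    rw [← Real.rpow_natCast, ← Real.rpow_mul hWpos.le, one_div (w ^ _), ← Real.rpow_neg hWpos.le]
    norm_num
  rw [e]
  ring

noncomputable def MM (ε r : ℝ) : ℝ := r * ε ^ 4 / (ε ^ 4 + r ^ 2) ^ 2

noncomputable def GG (γ ε x r : ℝ) : ℝ :=
  r * ((gg (ε ^ γ) ε r ^ 2 * (-Real.sin (fe ε r) * fder ε r) + x * hder ε r)
    / urho γ ε r x ^ 2) ^ 2 + r * (urho γ ε r x * fder ε r) ^ 2

noncomputable def KK (η ε : ℝ) : ℝ := 2 * ε + 2 * ε + 40 * η + 100 * η ^ 2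

noncomputable def DD (η : ℝ) : ℝ := 4 * η * (2 + 4 * η)

lemma pointwise {γ ε r x : ℝ} (hγ : γ ≤ 1 / 3) (hε : 0 < ε) (h1 : ε ≤ 1) (hr : 0 < r)
    (hrε : r < ε) (hx : 0 < x) (hx1 : x < 1) :
    ‖GG γ ε x r - MM ε r‖ ≤ DD (ε ^ γ) * (MM ε r + 2) + KK (ε ^ γ) ε / ε := by
  obtain ⟨-, hu, hu3⟩ := deriv_urho (γ := γ) hε h1 hr hrε hx
  obtain ⟨hf0, hf1, -, hF, hrF, hh40, hh8⟩ := basic hε h1 hr hrε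
  obtain ⟨ha1, ha2⟩ := arctan_bounds hε h1
  have hsin : 0 < Real.sin (fe ε r) := by linarith [sin_ge_half hf0.le hf1]
  have hcos : 0 ≤ Real.cos (fe ε r) := Real.cos_nonneg_of_mem_Icc ⟨by linarith, hf1⟩
  have hη : 0 < ε ^ γ := Real.rpow_pos_of_pos hε γ
  have hF0 : 0 < fder ε r := by linarith
  have hh0 : 0 ≤ hh ε r := by unfold hh; positivity
  have hεη : ε ≤ (ε ^ γ) ^ 3 := by
    rw [← Real.rpow_natCast, ← Real.rpow_mul hε.le]
    calc ε = ε ^ (1 : ℝ) := (Real.rpow_one ε).symm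
      _ ≤ _ := Real.rpow_le_rpow_of_exponent_ge hε h1 (by push_cast; linarith)
  have hR : 0 < ε ^ 4 + r ^ 2 := by positivity
  set p := ε ^ 2 / (ε ^ 4 + r ^ 2) with hp
  have hp0 : 0 < p := by positivity
  have hMp : MM ε r = r * p ^ 2 := by unfold MM; rw [hp]; field_simp
  have hFp : fder ε r = p + Real.arctan ε / ε := rfl
  have hrp : r * p ≤ 1 / 2 := by
    rw [hp, ← mul_div_assoc, div_le_div_iff₀ hR (by norm_num)]
    nlinarith [sq_nonneg (r - ε ^ 2)]
  have hM1 : MM ε r ≤ r * fder ε r ^ 2 := by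
    rw [hMp, hFp]; gcongr; linarith
  have hM2 : r * fder ε r ^ 2 ≤ MM ε r + 2 := by
    rw [hMp, hFp]
    set a := Real.arctan ε / ε
    have e1 : r * p * a ≤ 1 / 2 * 1 := by gcongr
    have e2 : r * a ^ 2 ≤ 1 * 1 ^ 2 := by gcongr; linarith
    nlinarith
  have hhr : Real.sin (fe ε r) * fder ε r * hh ε r = r := by
    unfold hh; field_simp
  have := algebra (M := MM ε r) hε hr hrε hη hεη hx hx1 hF hrF hh40 hh0 hh8 hcos hsin.le
    (Real.sin_sq_add_cos_sq _) (rfl : gg (ε ^ γ) ε r = _) hu hu3 hhr hM1 hM2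
  rw [abs_mul, abs_of_pos hε] at this
  have h2 : ε * |GG γ ε x r - MM ε r| ≤
      ε * (DD (ε ^ γ) * (MM ε r + 2) + KK (ε ^ γ) ε / ε) := by
    refine this.trans (le_of_eq ?_)
    unfold DD KK
    field_simp
  exact le_of_mul_le_mul_left h2 hε

lemma continuous_MM {ε : ℝ} (hε : 0 < ε) : Continuous (MM ε) := by
  unfold MM
  apply Continuous.div (by fun_prop) (by fun_prop)
  intro r
  positivity

lemma integral_MM {ε : ℝ} (hε : 0 < ε) :
    ∫ r in Set.Ioo 0 ε, MM ε r = 1 / 2 - ε ^ 2 / (2 * (ε ^ 2 + 1)) := by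
  rw [← integral_Ioc_eq_integral_Ioo, ← intervalIntegral.integral_of_le hε.le]
  have hd : ∀ r ∈ Set.uIcc 0 ε,
      HasDerivAt (fun r => -(ε ^ 4 / 2) / (ε ^ 4 + r ^ 2)) (MM ε r) r := by
    intro r _
    have hp : ε ^ 4 + r ^ 2 ≠ 0 := by positivity
    have h1 : HasDerivAt (fun r : ℝ => ε ^ 4 + r ^ 2) (2 * r) r := by
      simpa using (hasDerivAt_pow 2 r).const_add (ε ^ 4)
    have h := (hasDerivAt_const r (-(ε ^ 4 / 2))).div h1 hp
    refine h.congr_deriv ?_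
    unfold MM
    field_simp
    ring
  rw [intervalIntegral.integral_eq_sub_of_hasDerivAt hd
    ((continuous_MM hε).intervalIntegrable _ _)]
  field_simp
  ring

lemma integrable_MM {ε : ℝ} (hε : 0 < ε) : IntegrableOn (MM ε) (Set.Ioo 0 ε) :=
  ((continuous_MM hε).integrableOn_Icc (a := 0) (b := ε)).mono_set Set.Ioo_subset_Icc_self

lemma measurable_GG (γ ε : ℝ) : Measurable (Function.uncurry (GG γ ε)) := by
  unfold GG urho hder gg fdd fder fe Function.uncurry
  fun_prop

lemma inner_est {γ ε x : ℝ} (hγ : γ ≤ 1 / 3) (hε : 0 < ε) (h1 : ε ≤ 1)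
    (hx : 0 < x) (hx1 : x < 1) :
    ‖(∫ r in Set.Ioo 0 ε, GG γ ε x r) - ∫ r in Set.Ioo 0 ε, MM ε r‖
      ≤ DD (ε ^ γ) * (1 / 2 + 2 * ε) + KK (ε ^ γ) ε := by
  have hη : 0 < ε ^ γ := Real.rpow_pos_of_pos hε γ
  have hD : 0 ≤ DD (ε ^ γ) := by unfold DD; positivity
  have hB : IntegrableOn (fun r => DD (ε ^ γ) * (MM ε r + 2) + KK (ε ^ γ) ε / ε)
      (Set.Ioo 0 ε) := by
    have : Continuous (fun r => DD (ε ^ γ) * (MM ε r + 2) + KK (ε ^ γ) ε / ε) := by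
      have := continuous_MM hε
      fun_prop
    exact (this.integrableOn_Icc (a := 0) (b := ε)).mono_set Set.Ioo_subset_Icc_self
  have hbd : ∀ᵐ r ∂(volume.restrict (Set.Ioo 0 ε)), ‖GG γ ε x r - MM ε r‖ ≤
      DD (ε ^ γ) * (MM ε r + 2) + KK (ε ^ γ) ε / ε := by
    filter_upwards [ae_restrict_mem measurableSet_Ioo] with r hr
    exact pointwise hγ hε h1 hr.1 hr.2 hx hx1
  have hGm : Measurable (GG γ ε x) := (measurable_GG γ ε).of_uncurry_left
  have hdiff : IntegrableOn (fun r => GG γ ε x r - MM ε r) (Set.Ioo 0 ε) :=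
    Integrable.mono' hB (hGm.sub (continuous_MM hε).measurable).aestronglyMeasurable hbd
  have hG : IntegrableOn (GG γ ε x) (Set.Ioo 0 ε) := by
    have := Integrable.add hdiff (integrable_MM hε)
    refine this.congr (Filter.Eventually.of_forall fun r => ?_)
    simp
  rw [← integral_sub hG (integrable_MM hε)]
  refine (norm_integral_le_of_norm_le hB hbd).trans ?_
  have hM := integrable_MM hε
  have hc : ∀ c : ℝ, IntegrableOn (fun _ : ℝ => c) (Set.Ioo 0 ε) := fun c => by
    simp [integrableOn_const_iff]
  have hval : ∫ r in Set.Ioo 0 ε, (DD (ε ^ γ) * (MM ε r + 2) + KK (ε ^ γ) ε / ε)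
      = DD (ε ^ γ) * ((∫ r in Set.Ioo 0 ε, MM ε r) + 2 * ε) + KK (ε ^ γ) ε := by
    have hM2 : IntegrableOn (fun r => MM ε r + 2) (Set.Ioo 0 ε) := hM.add (hc 2)
    rw [integral_add (hM2.const_mul _) (hc _), integral_const_mul,
      integral_add hM (hc 2)]
    simp [hε.le]
    field_simp
  rw [hval, integral_MM hε]
  have : 0 ≤ ε ^ 2 / (2 * (ε ^ 2 + 1)) := by positivity
  gcongr
  linarith

lemma outer_est {γ ε : ℝ} (hγ : γ ≤ 1 / 3) (hε : 0 < ε) (h1 : ε ≤ 1) :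
    ‖(∫ x in Set.Ioo (0 : ℝ) 1, ∫ r in Set.Ioo (0 : ℝ) ε,
          (r * (deriv (fun t => urho γ ε t x) r) ^ 2
            + r * (urho γ ε r x * fder ε r) ^ 2)) - (1 / 2 - ε ^ 2 / (2 * (ε ^ 2 + 1)))‖
      ≤ DD (ε ^ γ) * (1 / 2 + 2 * ε) + KK (ε ^ γ) ε := by
  have hcongr : (∫ x in Set.Ioo (0 : ℝ) 1, ∫ r in Set.Ioo (0 : ℝ) ε,
          (r * (deriv (fun t => urho γ ε t x) r) ^ 2
            + r * (urho γ ε r x * fder ε r) ^ 2))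
      = ∫ x in Set.Ioo (0 : ℝ) 1, ∫ r in Set.Ioo (0 : ℝ) ε, GG γ ε x r := by
    refine setIntegral_congr_fun measurableSet_Ioo fun x hx => ?_
    refine setIntegral_congr_fun measurableSet_Ioo fun r hr => ?_
    simp only [GG]
    rw [(deriv_urho hε h1 hr.1 hr.2 hx.1).1]
  rw [hcongr, ← integral_MM hε]
  set m := ∫ r in Set.Ioo 0 ε, MM ε r
  set B := DD (ε ^ γ) * (1 / 2 + 2 * ε) + KK (ε ^ γ) ε
  have hm : StronglyMeasurable fun x => ∫ r in Set.Ioo (0 : ℝ) ε, GG γ ε x r :=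
    (measurable_GG γ ε).stronglyMeasurable.integral_prod_right
  have hbd : ∀ x ∈ Set.Ioo (0 : ℝ) 1, ‖(∫ r in Set.Ioo (0 : ℝ) ε, GG γ ε x r) - m‖ ≤ B :=
    fun x hx => inner_est hγ hε h1 hx.1 hx.2
  have hc : ∀ c : ℝ, IntegrableOn (fun _ : ℝ => c) (Set.Ioo 0 1) := fun c => by
    simp [integrableOn_const_iff]
  have hdiff : IntegrableOn (fun x => (∫ r in Set.Ioo (0 : ℝ) ε, GG γ ε x r) - m)
      (Set.Ioo 0 1) := by
    refine Integrable.mono' (hc B) (hm.sub stronglyMeasurable_const).aestronglyMeasurable ?_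
    filter_upwards [ae_restrict_mem measurableSet_Ioo] with x hx
    exact hbd x hx
  have hI : IntegrableOn (fun x => ∫ r in Set.Ioo (0 : ℝ) ε, GG γ ε x r) (Set.Ioo 0 1) := by
    have := Integrable.add hdiff (hc m)
    refine this.congr (Filter.Eventually.of_forall fun r => ?_)
    simp
  have hmc : m = ∫ _x in Set.Ioo (0 : ℝ) 1, m := by simp
  rw [hmc, ← integral_sub hI (hc m)]
  have := norm_setIntegral_le_of_norm_le_const (μ := volume) (s := Set.Ioo (0 : ℝ) 1) (by simp) hbd
  simpa using this

/-- for `0 < γ ≤ 1/3`,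
`lim_{ε→0⁺} ∫₀¹ ∫₀^ε [ r·(∂_r u_ρ^ε)² + r·(u_ρ^ε·f_ε')² ] dr dx₃ = 1/2`. -/
theorem energy_part_I (γ : ℝ) (hγ0 : 0 < γ) (hγ : γ ≤ 1 / 3) :
    Tendsto (fun ε : ℝ =>
        ∫ x in Set.Ioo (0 : ℝ) 1, ∫ r in Set.Ioo (0 : ℝ) ε,
          (r * (deriv (fun t => urho γ ε t x) r) ^ 2
            + r * (urho γ ε r x * fder ε r) ^ 2))
      (𝓝[>] 0) (𝓝 (1 / 2)) := by
  have hη : Tendsto (fun ε : ℝ => ε ^ γ) (𝓝[>] 0) (𝓝 0) := by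
    have h : Tendsto (fun ε : ℝ => ε ^ γ) (𝓝 0) (𝓝 ((0 : ℝ) ^ γ)) :=
      (Real.continuousAt_rpow_const 0 γ (Or.inr hγ0.le)).tendsto
    rw [Real.zero_rpow hγ0.ne'] at h
    exact h.mono_left nhdsWithin_le_nhds
  have hid : Tendsto (fun ε : ℝ => ε) (𝓝[>] 0) (𝓝 0) := nhdsWithin_le_nhds
  have hm : Tendsto (fun ε : ℝ => 1 / 2 - ε ^ 2 / (2 * (ε ^ 2 + 1))) (𝓝[>] 0) (𝓝 (1 / 2)) := by
    have hc : Continuous (fun ε : ℝ => 1 / 2 - ε ^ 2 / (2 * (ε ^ 2 + 1))) := by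
      refine continuous_const.sub (Continuous.div (by fun_prop) (by fun_prop) ?_)
      intro ε
      positivity
    have := (hc.tendsto 0).mono_left (nhdsWithin_le_nhds (s := Set.Ioi 0))
    simpa using this
  have hB : Tendsto (fun ε : ℝ => DD (ε ^ γ) * (1 / 2 + 2 * ε) + KK (ε ^ γ) ε)
      (𝓝[>] 0) (𝓝 0) := by
    have hc : Continuous (fun p : ℝ × ℝ => DD p.1 * (1 / 2 + 2 * p.2) + KK p.1 p.2) := by
      unfold DD KK
      fun_prop
    have h := (hc.tendsto (0, 0)).comp (hη.prodMk_nhds hid)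
    have h0 : DD 0 * (1 / 2 + 2 * 0) + KK 0 0 = 0 := by simp [DD, KK]
    simp only [h0] at h
    exact h
  have hdiff := squeeze_zero_norm' (f := fun ε : ℝ =>
      (∫ x in Set.Ioo (0 : ℝ) 1, ∫ r in Set.Ioo (0 : ℝ) ε,
          (r * (deriv (fun t => urho γ ε t x) r) ^ 2
            + r * (urho γ ε r x * fder ε r) ^ 2)) - (1 / 2 - ε ^ 2 / (2 * (ε ^ 2 + 1))))
    (by
      filter_upwards [Ioc_mem_nhdsGT (zero_lt_one (α := ℝ))] with ε hε
      exact outer_est hγ hε.1 hε.2) hB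
  simpa using hdiff.add hm
end

section
/- Fix γ with 0 < γ ≤ 1/3. Then lim_{ε→0⁺} ∫_{x₃=0}^{1} ∫_{r=0}^{ε} r·(∂u_ρ^ε/∂x₃ (r, x₃))² dr dx₃ = 0, where ∂u_ρ^ε/∂x₃ (r, x₃) = (u_ρ^ε(r, x₃))^{-2}·r/(sin(f_ε(r))·f_ε'(r)). -/
open MeasureTheory Filter Topology Real

theorem half_le_arctan {ε : ℝ} (h0 : 0 < ε) (h1 : ε < 1) : ε / 2 ≤ Real.arctan ε := by
  have ha : 0 < Real.arctan ε := Real.arctan_pos.2 h0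
  have h := Real.sin_le ha.le
  rw [Real.sin_arctan] at h
  refine le_trans ?_ h
  have hs : √(1 + ε ^ 2) ≤ 2 := by
    rw [Real.sqrt_le_left (by norm_num)]
    nlinarith
  have hp : 0 < √(1 + ε ^ 2) := Real.sqrt_pos.2 (by positivity)
  gcongr

theorem integrand_bound {γ ε r x : ℝ} (hγ : γ ≤ 1 / 3) (h0 : 0 < ε) (h1 : ε < 1)
    (hr0 : 0 < r) (hr : r < ε) (hx : 0 < x) :
    ‖r * ((urho γ ε r x ^ 2)⁻¹ * (r / (Real.sin (fe ε r) * fder ε r))) ^ 2‖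
      ≤ 4 * π ^ 2 / ε ^ ((1 : ℝ) / 3) := by
  have ha := half_le_arctan h0 h1
  have hapos : 0 < Real.arctan ε := Real.arctan_pos.2 h0
  have hd : 1 / 2 ≤ fder ε r := by
    have e1 : 0 ≤ ε ^ 2 / (ε ^ 4 + r ^ 2) := by positivity
    have e2 : 1 / 2 ≤ Real.arctan ε / ε := by
      rw [le_div_iff₀ h0]; linarith
    unfold fder; linarith
  have hflow : r / 2 ≤ fe ε r := by
    have e1 : 0 < Real.arctan (r / ε ^ 2) := Real.arctan_pos.2 (by positivity)
    have e2 : r / 2 ≤ Real.arctan ε * r / ε := by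
      rw [le_div_iff₀ h0]; nlinarith
    unfold fe; linarith
  have hfup : fe ε r ≤ π / 2 := by
    have e1 : Real.arctan (r / ε ^ 2) ≤ π / 2 - Real.arctan ε := by
      rw [← Real.arctan_inv_of_pos h0]
      apply Real.arctan_strictMono.monotone
      rw [div_le_iff₀ (by positivity)]
      have : ε⁻¹ * ε ^ 2 = ε := by field_simp
      linarith
    have e2 : Real.arctan ε * r / ε ≤ Real.arctan ε := by
      rw [div_le_iff₀ h0]; nlinarith
    unfold fe; linarith
  have hsin : r / π ≤ Real.sin (fe ε r) := by
    have := Real.mul_le_sin (by linarith) hfup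
    refine le_trans ?_ this
    have : 2 / π * (r / 2) ≤ 2 / π * fe ε r := by gcongr
    refine le_trans (le_of_eq ?_) this
    field_simp
  have hcos : 0 ≤ Real.cos (fe ε r) :=
    Real.cos_nonneg_of_mem_Icc ⟨by linarith [Real.pi_pos], hfup⟩
  have hpi := Real.pi_pos
  have hsin0 : 0 ≤ Real.sin (fe ε r) := le_trans (by positivity) hsin
  have hprod : r / π * (1 / 2) ≤ Real.sin (fe ε r) * fder ε r := by gcongr
  have hprod0 : 0 < Real.sin (fe ε r) * fder ε r := lt_of_lt_of_le (by positivity) hprod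
  have hA : r / (Real.sin (fe ε r) * fder ε r) ≤ 2 * π := by
    rw [div_le_iff₀ hprod0]
    calc r = 2 * π * (r / π * (1 / 2)) := by field_simp
      _ ≤ _ := by gcongr
  have hA0 : 0 ≤ r / (Real.sin (fe ε r) * fder ε r) := by positivity
  set t := ε ^ ((1 : ℝ) / 3) with ht
  have ht0 : 0 < t := Real.rpow_pos_of_pos h0 _
  have ht3 : t ^ 3 = ε := by
    rw [ht, ← Real.rpow_natCast, ← Real.rpow_mul h0.le]; norm_num
  have htγ : t ≤ ε ^ γ := Real.rpow_le_rpow_of_exponent_ge h0 h1.le hγ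
  have hB : ε ≤ (Real.cos (fe ε r) + 2 * ε ^ γ) ^ 3
      + 3 * x * r / (Real.sin (fe ε r) * fder ε r) := by
    have e1 : 0 ≤ 3 * x * r / (Real.sin (fe ε r) * fder ε r) := by positivity
    have e2 : t ^ 3 ≤ (Real.cos (fe ε r) + 2 * ε ^ γ) ^ 3 := by
      gcongr; linarith
    linarith
  have hu : t ≤ urho γ ε r x := Real.rpow_le_rpow h0.le hB (by norm_num)
  generalize urho γ ε r x = u at *
  generalize r / (Real.sin (fe ε r) * fder ε r) = A at *
  have hu0 : 0 < u := ht0.trans_le hu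
  rw [Real.norm_of_nonneg (by positivity)]
  calc r * ((u ^ 2)⁻¹ * A) ^ 2 ≤ t ^ 3 * ((t ^ 2)⁻¹ * (2 * π)) ^ 2 := by
        have : r ≤ t ^ 3 := by linarith
        gcongr
    _ = 4 * π ^ 2 / t := by field_simp; ring

/-- for `0 < γ ≤ 1/3`,
`lim_{ε→0⁺} ∫₀¹ ∫₀^ε r·(∂u_ρ^ε/∂x₃)² dr dx₃ = 0`, where
`∂u_ρ^ε/∂x₃ (r, x₃) = (u_ρ^ε(r,x₃))^{-2}·r/(sin(f_ε(r))·f_ε'(r))`. -/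
theorem energy_part_III (γ : ℝ) (hγ0 : 0 < γ) (hγ : γ ≤ 1 / 3) :
    Tendsto (fun ε : ℝ =>
        ∫ x in Set.Ioo (0 : ℝ) 1, ∫ r in Set.Ioo (0 : ℝ) ε,
          r * ((urho γ ε r x ^ 2)⁻¹ * (r / (Real.sin (fe ε r) * fder ε r))) ^ 2)
      (𝓝[>] 0) (𝓝 0) := by
  have hlim : Tendsto (fun ε : ℝ => 4 * π ^ 2 / ε ^ ((1 : ℝ) / 3) * ε) (𝓝[>] 0) (𝓝 0) := by
    have h1 : Tendsto (fun ε : ℝ => 4 * π ^ 2 * ε ^ ((2 : ℝ) / 3)) (𝓝[>] 0) (𝓝 0) := by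
      have hc : ContinuousAt (fun ε : ℝ => 4 * π ^ 2 * ε ^ ((2 : ℝ) / 3)) 0 :=
        continuousAt_const.mul (Real.continuousAt_rpow_const _ _ (Or.inr (by norm_num)))
      have h2 := hc.tendsto
      rw [Real.zero_rpow (by norm_num), mul_zero] at h2
      exact h2.mono_left nhdsWithin_le_nhds
    refine h1.congr' ?_
    filter_upwards [self_mem_nhdsWithin] with ε hε
    have hε : 0 < ε := hε
    have e : ε ^ ((2 : ℝ) / 3) * ε ^ ((1 : ℝ) / 3) = ε := by
      rw [← Real.rpow_add hε]; norm_num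
    have hp : 0 < ε ^ ((1 : ℝ) / 3) := Real.rpow_pos_of_pos hε _
    rw [div_mul_eq_mul_div, eq_div_iff hp.ne', mul_assoc, e]
  refine squeeze_zero_norm' ?_ hlim
  filter_upwards [Ioo_mem_nhdsGT (zero_lt_one : (0 : ℝ) < 1)] with ε hε
  have hin : ∀ x ∈ Set.Ioo (0 : ℝ) 1, ‖∫ r in Set.Ioo (0 : ℝ) ε,
      r * ((urho γ ε r x ^ 2)⁻¹ * (r / (Real.sin (fe ε r) * fder ε r))) ^ 2‖
      ≤ 4 * π ^ 2 / ε ^ ((1 : ℝ) / 3) * ε := by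
    intro x hx
    have := norm_setIntegral_le_of_norm_le_const (μ := volume) (s := Set.Ioo (0 : ℝ) ε)
      (by simp) (fun r hr => integrand_bound (γ := γ) (x := x) hγ hε.1 hε.2 hr.1 hr.2 hx.1)
    simpa [hε.1.le] using this
  have := norm_setIntegral_le_of_norm_le_const (μ := volume) (s := Set.Ioo (0 : ℝ) 1)
    (by simp) hin
  simpa using this
end
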